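/- arXiv:1910.11556 — 4 statements merged into one kernel-verified Lean document; each statement's English description precedes it below -/
import Mathlib

section
/- Let K be a number field of degree n over ℚ. Suppose that for every prime number p dividing n, the square p² does not divide the discriminant d_K of K. Then the trace map Tr : O_K → ℤ, restricting the field trace of K/ℚ to the ring of integers O_K, is surjective. -/
open NumberField

/-- If for every prime `p` dividing the degree `n = [K : ℚ]`, `p ^ 2` does not divide the
discriminant of `K`, then the trace map `Tr : 𝓞 K → ℤ` is surjective. -/
theorem trace_surjective_of_sq_prime_factors_of_degree_not_dvd_discr
    (K : Type*) [Field K] [NumberField K]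
    (h : ∀ p : ℕ, p.Prime → p ∣ Module.finrank ℚ K →
      ¬ ((p : ℤ) ^ 2 ∣ NumberField.discr K)) :
    Function.Surjective (Algebra.trace ℤ (𝓞 K)) := by
  rw [← LinearMap.range_eq_top]
  by_contra hne
  obtain ⟨M, hM, hle⟩ := Ideal.exists_le_maximal (LinearMap.range (Algebra.trace ℤ (𝓞 K))) hne
  obtain ⟨g, hg⟩ := (IsPrincipalIdealRing.principal M).principal
  have hdvd : ∀ x, g.natAbs ∣ (Algebra.trace ℤ (𝓞 K) x).natAbs := by
    intro x
    have : Algebra.trace ℤ (𝓞 K) x ∈ M := hle ⟨x, rfl⟩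
    rw [hg] at this
    exact Int.natAbs_dvd_natAbs.mpr (Ideal.mem_span_singleton.mp this)
  have hg1 : g.natAbs ≠ 1 := by
    intro h1
    apply hM.ne_top
    rw [hg]
    exact Ideal.span_singleton_eq_top.mpr (Int.isUnit_iff_natAbs_eq.mpr h1)
  obtain ⟨p, hp, hpg⟩ := Nat.exists_prime_and_dvd hg1
  have hpd : ∀ x, (p : ℤ) ∣ Algebra.trace ℤ (𝓞 K) x := fun x =>
    Int.natCast_dvd.mpr (hpg.trans (hdvd x))
  have hn : p ∣ Module.finrank ℚ K := by
    have h1 := hpd (algebraMap ℤ (𝓞 K) 1)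
    rw [Algebra.trace_algebraMap, RingOfIntegers.rank] at h1
    simpa [Int.natCast_dvd_natCast] using h1
  refine h p hp hn ?_
  have h2 : 2 ≤ Module.finrank ℚ K :=
    hp.two_le.trans (Nat.le_of_dvd Module.finrank_pos hn)
  refine (pow_dvd_pow (p : ℤ) h2).trans ?_
  choose c hc using hpd
  classical
  have hmat : Algebra.traceMatrix ℤ (RingOfIntegers.basis K) =
      (p : ℤ) • Matrix.of (fun i j => c (RingOfIntegers.basis K i * RingOfIntegers.basis K j)) := by
    ext i j
    simp [Algebra.traceMatrix_apply, Algebra.traceForm_apply, ← hc]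
  rw [← discr_eq_discr K (RingOfIntegers.basis K), Algebra.discr_def, hmat, Matrix.det_smul,
    ← Module.finrank_eq_card_basis (RingOfIntegers.basis K), RingOfIntegers.rank]
  exact dvd_mul_right _ _
end

section
/- Let K be a number field of degree n and let t be the nonnegative generator of the ideal Tr(O_K) of ℤ, where Tr is the field trace of K/ℚ restricted to O_K. Then t² divides the discriminant d_K of K. -/
open NumberField

/-- If `t` is the nonnegative generator of the image ideal `Tr(𝓞 K) ⊆ ℤ` of the trace map,
then `t ^ 2` divides the discriminant of `K`. -/
theorem sq_of_trace_ideal_generator_dvd_discr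
    (K : Type*) [Field K] [NumberField K] (t : ℕ)
    (ht : ∀ x : ℤ, x ∈ Set.range (Algebra.trace ℤ (𝓞 K)) ↔ (t : ℤ) ∣ x) :
    (t : ℤ) ^ 2 ∣ NumberField.discr K := by
  classical
  have h : ∀ x : 𝓞 K, (t : ℤ) ∣ Algebra.trace ℤ (𝓞 K) x := fun x => (ht _).1 ⟨x, rfl⟩
  let b := Module.finBasis ℤ (𝓞 K)
  have hpos : 0 < Module.finrank ℤ (𝓞 K) := Module.finrank_pos
  by_cases h1 : Module.finrank ℤ (𝓞 K) = 1
  · have h2 := h (algebraMap ℤ (𝓞 K) 1)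
    rw [Algebra.trace_algebraMap_of_basis b] at h2
    simp only [Fintype.card_fin, h1, one_smul] at h2
    have h3 := pow_dvd_pow_of_dvd h2 2
    rw [one_pow] at h3
    exact h3.trans (one_dvd _)
  · have hd : (t : ℤ) ^ Module.finrank ℤ (𝓞 K) ∣ NumberField.discr K := by
      rw [← NumberField.discr_eq_discr K b, Algebra.discr_def]
      choose f hf using h
      have hM : Algebra.traceMatrix ℤ b = (t : ℤ) • Matrix.of (fun i j => f (b i * b j)) := by
        ext i j
        simp [Algebra.traceMatrix_apply, Algebra.traceForm_apply, hf (b i * b j)]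
      rw [hM, Matrix.det_smul, Fintype.card_fin]
      exact dvd_mul_right _ _
    exact (pow_dvd_pow _ (by omega)).trans hd
end

section
/- Let K be a number field whose discriminant d_K is squarefree. Then the trace map Tr : O_K → ℤ, restricting the field trace of K/ℚ to the ring of integers O_K, is surjective. -/
open NumberField

/-- If the discriminant of a number field `K` is squarefree, then the trace map
`Tr : 𝓞 K → ℤ` is surjective. -/
theorem trace_surjective_of_squarefree_discr
    (K : Type*) [Field K] [NumberField K]
    (h : Squarefree (NumberField.discr K)) :
    Function.Surjective (Algebra.trace ℤ (𝓞 K)) := by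
  obtain ⟨d, hd⟩ := (IsPrincipalIdealRing.principal
    (LinearMap.range (Algebra.trace ℤ (𝓞 K)) : Ideal ℤ)).principal
  have hdvd : ∀ x, d ∣ Algebra.trace ℤ (𝓞 K) x := fun x => by
    have hx : Algebra.trace ℤ (𝓞 K) x ∈ LinearMap.range (Algebra.trace ℤ (𝓞 K)) := ⟨x, rfl⟩
    rw [hd] at hx
    exact Ideal.mem_span_singleton.1 hx
  have hunit : IsUnit d := by
    have hpos : 0 < Module.finrank ℤ (𝓞 K) := Module.finrank_pos
    by_cases h1 : Module.finrank ℤ (𝓞 K) = 1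
    · have := hdvd 1
      rw [← map_one (algebraMap ℤ (𝓞 K)),
        Algebra.trace_algebraMap_of_basis (RingOfIntegers.basis K),
        ← Module.finrank_eq_card_basis (RingOfIntegers.basis K), h1, one_smul] at this
      exact isUnit_of_dvd_one this
    · apply h
      choose f hf using hdvd
      have hM : Algebra.traceMatrix ℤ (RingOfIntegers.basis K) =
          d • Matrix.of fun i j => f (RingOfIntegers.basis K i * RingOfIntegers.basis K j) := by
        ext i j
        simp [Algebra.traceMatrix_apply, Algebra.traceForm_apply, ← hf]
      rw [NumberField.discr, Algebra.discr_def, hM, Matrix.det_smul,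
        ← Module.finrank_eq_card_basis (RingOfIntegers.basis K), ← pow_two]
      exact (pow_dvd_pow d (by omega)).mul_right _
  rw [← LinearMap.range_eq_top, hd]
  exact Ideal.span_singleton_eq_top.2 hunit
end

section
/- For any number field K, if 2 divides the discriminant d_K, then 4 divides d_K; equivalently, the discriminant of a number field is never exactly divisible by 2 to the first power. -/
open NumberField

/-- If `2` divides the discriminant of a number field `K`, then `4` divides it: the
discriminant is never exactly divisible by `2` to the first power. -/
theorem four_dvd_discr_of_two_dvd
    (K : Type*) [Field K] [NumberField K]
    (h : (2 : ℤ) ∣ NumberField.discr K) : (4 : ℤ) ∣ NumberField.discr K := by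
  classical
  let E := AlgebraicClosure ℚ
  have hcl : IsAlgClosure ℚ E := by
    convert! (AlgebraicClosure.instIsAlgClosure ℚ)
  have : IsGalois ℚ E := IsAlgClosure.isGalois ℚ E
  let ι := Module.Free.ChooseBasisIndex ℤ (𝓞 K)
  let b := integralBasis K
  obtain ⟨e⟩ : Nonempty (ι ≃ (K →ₐ[ℚ] E)) := by
    rw [← Fintype.card_eq, AlgHom.card, Module.finrank_eq_card_basis b]
  have hM : ∀ i j, Algebra.embeddingsMatrixReindex ℚ E b e i j = e j (b i) := fun i j => by
    simp [Algebra.embeddingsMatrixReindex, Algebra.embeddingsMatrix]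
  have hd := Algebra.discr_eq_det_embeddingsMatrixReindex_pow_two ℚ E b e
  rw [← coe_discr] at hd
  generalize Algebra.embeddingsMatrixReindex ℚ E b e = M at hM hd
  have hint : ∀ i j, IsIntegral ℤ (M i j) := fun i j => by
    rw [hM, integralBasis_apply]
    exact (RingOfIntegers.isIntegral_coe _).map ((e j).restrictScalars ℤ)
  have hterm : ∀ s : Equiv.Perm ι, IsIntegral ℤ (∏ i, M (s i) i) := fun s =>
    IsIntegral.prod _ fun i _ => hint _ _
  have hPint : IsIntegral ℤ M.permanent := IsIntegral.sum _ fun s _ => hterm s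
  -- determinant and permanent agree modulo 2
  obtain ⟨N, hNint, hN⟩ : ∃ N : E, IsIntegral ℤ N ∧ M.det = M.permanent - 2 * N := by
    refine ⟨∑ s : Equiv.Perm ι, if Equiv.Perm.sign s = 1 then 0 else ∏ i, M (s i) i,
      IsIntegral.sum _ fun s _ => ?_, ?_⟩
    · split_ifs
      · exact isIntegral_zero
      · exact hterm s
    · rw [Matrix.det_apply, Matrix.permanent, Finset.mul_sum, ← Finset.sum_sub_distrib]
      refine Finset.sum_congr rfl fun s _ => ?_
      rcases Int.units_eq_one_or (Equiv.Perm.sign s) with hs | hs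
      · simp [hs]
      · simp [hs]; ring
  -- the permanent is Galois invariant
  have hPrat : M.permanent ∈ Set.range (algebraMap ℚ E) := by
    rw [InfiniteGalois.mem_range_algebraMap_iff_fixed]
    intro f
    let c : (K →ₐ[ℚ] E) ≃ (K →ₐ[ℚ] E) :=
      { toFun := fun g => (f : E →ₐ[ℚ] E).comp g
        invFun := fun g => (f.symm : E →ₐ[ℚ] E).comp g
        left_inv := fun g => by ext x; simp
        right_inv := fun g => by ext x; simp }
    let t : Equiv.Perm ι := (e.trans c).trans e.symm
    rw [← Matrix.permanent_permute_rows t M]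
    conv_lhs => rw [Matrix.permanent_permute_rows t M]
    simp only [Matrix.permanent, map_sum, map_prod]
    refine Finset.sum_congr rfl fun s _ => Finset.prod_congr rfl fun i _ => ?_
    simp [hM, t, c]
  have key : ∀ q : ℚ, IsIntegral ℤ (algebraMap ℚ E q) → ∃ a : ℤ, (a : ℚ) = q := fun q hq => by
    have := (isIntegral_algebraMap_iff (algebraMap ℚ E).injective).1 hq
    simpa using IsIntegrallyClosed.isIntegral_iff.1 this
  obtain ⟨q, hq⟩ := hPrat
  obtain ⟨a, rfl⟩ := key q (hq ▸ hPint)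
  obtain ⟨m, hm⟩ := key (((discr K : ℚ) - (a : ℚ) ^ 2) / 4) (by
    have : algebraMap ℚ E (((discr K : ℚ) - (a : ℚ) ^ 2) / 4) = N ^ 2 - M.permanent * N := by
      rw [map_div₀, map_sub, map_pow, hd, hq, hN]
      rw [map_ofNat]
      ring
    rw [this]
    exact (hNint.pow 2).sub (hPint.mul hNint))
  have hfin : discr K = a ^ 2 + 4 * m := by
    have : (discr K : ℚ) = (a : ℚ) ^ 2 + 4 * m := by rw [hm]; ring
    exact_mod_cast this
  have ha : (2 : ℤ) ∣ a := by
    have : (2 : ℤ) ∣ a ^ 2 := by omega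
    exact Int.prime_two.dvd_of_dvd_pow this
  obtain ⟨k, rfl⟩ := ha
  exact ⟨k ^ 2 + m, by rw [hfin]; ring⟩
end
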